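/- Fix an integer ν ≥ 3. Suppose M = M(n) is a sequence of positive integers with M(n) → ∞ and log M(n) = O(n), and suppose n/log M(n) converges to a limit κ with κ > 2(ν−1)/log((1 − 2ν^{−2})^{−1}). Then limsup_{n→∞} E[Z_n²] / (E[Z_n])² ≤ ν². -/

import Mathlib

open Filter

/-- The number of perfect ordered partitions of `{1,…,n}` into `ν` nonempty parts. -/
noncomputable def perfectCount (ν n : ℕ) (X : Fin n → ℕ) : ℕ :=
  Set.ncard {σ : Fin n → Fin ν | Function.Surjective σ ∧
    ∀ α β : Fin ν,
      (∑ j ∈ Finset.univ.filter fun j => σ j = α, X j) =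
      (∑ j ∈ Finset.univ.filter fun j => σ j = β, X j)}

/-- `E[Z_n]` for `X_1,…,X_n` i.i.d. uniform on `{1,…,M}`. -/
noncomputable def EZ (ν n M : ℕ) : ℝ :=
  (∑ X : Fin n → Fin M, ((perfectCount ν n fun j => (X j : ℕ) + 1) : ℝ)) / (M : ℝ) ^ n

/-- `E[Z_n²]` for `X_1,…,X_n` i.i.d. uniform on `{1,…,M}`. -/
noncomputable def EZsq (ν n M : ℕ) : ℝ :=
  (∑ X : Fin n → Fin M, ((perfectCount ν n fun j => (X j : ℕ) + 1) : ℝ) ^ 2) / (M : ℝ) ^ n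

open MeasureTheory Topology
open scoped Real

/-- The characteristic function of the uniform distribution on `{1,…,M}`, at frequency `t`. -/
noncomputable def unifChar (M : ℕ) (t : ℝ) : ℂ :=
  (∑ m ∈ Finset.range M, Complex.exp (((2 * π * (m + 1) * t : ℝ) : ℂ) * Complex.I)) / M

lemma continuous_unifChar (M : ℕ) : Continuous (unifChar M) := by
  unfold unifChar
  fun_prop

lemma norm_unifChar_le_one (M : ℕ) (t : ℝ) : ‖unifChar M t‖ ≤ 1 := by
  unfold unifChar
  rw [norm_div, Complex.norm_natCast]
  refine div_le_one_of_le₀ ?_ (Nat.cast_nonneg _)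
  refine (norm_sum_le _ _).trans ?_
  simp only [Complex.norm_exp_ofReal_mul_I, Finset.sum_const, Finset.card_range, nsmul_eq_mul,
    mul_one, le_refl]

lemma four_mul_norm_le_norm_exp_sub_one (t : ℝ) :
    4 * ‖(t : UnitAddCircle)‖ ≤ ‖Complex.exp (((2 * π * t : ℝ) : ℂ) * Complex.I) - 1‖ := by
  rw [UnitAddCircle.norm_eq, mul_comm _ Complex.I, Complex.norm_exp_I_mul_ofReal_sub_one]
  have h1 : |t - round t| ≤ 1 / 2 := abs_sub_round t
  have h2 : |Real.sin (2 * π * t / 2)| = |Real.sin (π * (t - round t))| := by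
    have : π * (t - round t) = 2 * π * t / 2 - (round t : ℤ) * π := by ring
    rw [this, Real.sin_sub_int_mul_pi, abs_mul]
    simp
  rw [norm_mul, Real.norm_eq_abs, Real.norm_eq_abs, h2, abs_two]
  have h3 : |π * (t - round t)| ≤ π / 2 := by
    rw [abs_mul, abs_of_pos Real.pi_pos]
    nlinarith [Real.pi_pos]
  have h4 := Real.mul_abs_le_abs_sin h3
  rw [abs_mul, abs_of_pos Real.pi_pos, ← mul_assoc, div_mul_cancel₀ _ Real.pi_ne_zero] at h4
  linarith

lemma norm_unifChar_mul_le_one (M : ℕ) (t : ℝ) :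
    ‖unifChar M t‖ * (2 * M * ‖(t : UnitAddCircle)‖) ≤ 1 := by
  rcases Nat.eq_zero_or_pos M with rfl | hM
  · simp
  have hM' : (0 : ℝ) < M := by exact_mod_cast hM
  set z := Complex.exp (((2 * π * t : ℝ) : ℂ) * Complex.I) with hz
  have hz1 : ‖z‖ = 1 := Complex.norm_exp_ofReal_mul_I _
  have hsum : (∑ m ∈ Finset.range M, Complex.exp (((2 * π * (m + 1) * t : ℝ) : ℂ) * Complex.I))
      * (z - 1) = z * (z ^ M - 1) := by
    rw [← geom_sum_mul, ← mul_assoc, Finset.mul_sum]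
    congr 1
    refine Finset.sum_congr rfl fun m _ => ?_
    rw [← pow_succ', hz, ← Complex.exp_nat_mul]
    congr 1
    push_cast
    ring
  have hnorm : ‖unifChar M t‖ * (M * ‖z - 1‖) ≤ 2 := by
    unfold unifChar
    rw [norm_div, Complex.norm_natCast, div_mul_eq_mul_div, div_le_iff₀ hM', mul_left_comm,
      ← norm_mul, hsum, norm_mul, hz1, one_mul, mul_comm]
    refine mul_le_mul_of_nonneg_right ?_ hM'.le
    refine (norm_sub_le _ _).trans ?_
    rw [norm_pow, hz1]
    norm_num
  have h4 := four_mul_norm_le_norm_exp_sub_one t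
  have : ‖unifChar M t‖ * (M * (4 * ‖(t : UnitAddCircle)‖)) ≤ 2 :=
    le_trans (by gcongr) hnorm
  linarith

lemma cos_le_one_sub_mul_sq {x : ℝ} (hx : |x| ≤ 3 * π / 2) :
    Real.cos x ≤ 1 - 2 / (9 * π ^ 2) * x ^ 2 := by
  have hpi := Real.pi_pos
  have key : 2 / (3 * π) * |x / 2| ≤ |Real.sin (|x / 2|)| := by
    set y := |x / 2| with hy
    have hy0 : 0 ≤ y := abs_nonneg _
    have hy1 : y ≤ 3 * π / 4 := by
      rw [hy, abs_div, abs_two]; linarith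
    refine le_trans ?_ (le_abs_self _)
    have e : 2 / (3 * π) * y = 2 / π * (y / 3) := by field_simp
    rw [e]
    rcases le_total y (π / 2) with h | h
    · refine le_trans ?_ (Real.mul_le_sin hy0 h)
      gcongr
      linarith
    · rw [← Real.sin_pi_sub]
      refine le_trans ?_ (Real.mul_le_sin (by linarith) (by linarith))
      gcongr
      linarith
  have h1 : Real.sin (|x / 2|) ^ 2 = Real.sin (x / 2) ^ 2 := by
    rcases abs_choice (x / 2) with h | h <;> rw [h]
    rw [Real.sin_neg, neg_sq]
  have h2 : (2 / (3 * π) * |x / 2|) ^ 2 ≤ Real.sin (x / 2) ^ 2 := by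
    rw [← h1, ← sq_abs (Real.sin _)]
    gcongr
  have h3 : Real.cos x = 1 - 2 * Real.sin (x / 2) ^ 2 := by
    have := Real.cos_two_mul (x / 2)
    rw [mul_div_cancel₀ x two_ne_zero] at this
    rw [this, Real.cos_sq']
    ring
  rw [mul_pow, sq_abs] at h2
  rw [h3]
  have : 2 * ((2 / (3 * π)) ^ 2 * (x / 2) ^ 2) = 2 / (9 * π ^ 2) * x ^ 2 := by
    field_simp
    ring
  linarith

lemma norm_sum_exp_sq (s : Finset ℕ) (a : ℕ → ℝ) :
    ‖∑ m ∈ s, Complex.exp ((a m : ℂ) * Complex.I)‖ ^ 2 =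
      ∑ m ∈ s, ∑ k ∈ s, Real.cos (a m - a k) := by
  rw [Complex.sq_norm, Complex.normSq_apply]
  simp only [Complex.re_sum, Complex.im_sum, Complex.exp_ofReal_mul_I_re,
    Complex.exp_ofReal_mul_I_im, Real.cos_sub, Finset.sum_add_distrib, Finset.sum_mul_sum]

lemma sum_range_cast (M : ℕ) : ∑ m ∈ Finset.range M, (m : ℝ) = M * (M - 1) / 2 := by
  induction M with
  | zero => simp
  | succ M ih => rw [Finset.sum_range_succ, ih]; push_cast; ring

lemma sum_range_cast_sq (M : ℕ) :
    ∑ m ∈ Finset.range M, (m : ℝ) ^ 2 = M * (M - 1) * (2 * M - 1) / 6 := by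
  induction M with
  | zero => simp
  | succ M ih => rw [Finset.sum_range_succ, ih]; push_cast; ring

lemma sum_sum_range_sub_sq (M : ℕ) :
    ∑ m ∈ Finset.range M, ∑ k ∈ Finset.range M, ((m : ℝ) - k) ^ 2 =
      (M : ℝ) ^ 2 * ((M : ℝ) ^ 2 - 1) / 6 := by
  have : ∀ m k : ℕ, ((m : ℝ) - k) ^ 2 = (m : ℝ) ^ 2 - 2 * m * k + (k : ℝ) ^ 2 := by
    intros; ring
  simp only [this, Finset.sum_add_distrib, Finset.sum_sub_distrib, ← Finset.mul_sum,
    sum_range_cast_sq, sum_range_cast, Finset.sum_const, Finset.card_range, nsmul_eq_mul,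
    ← Finset.sum_mul]
  ring

lemma norm_unifChar_le_of_mul_le {M : ℕ} (hM : 2 ≤ M) {t : ℝ} (ht : M * |t| ≤ 3 / 4) :
    ‖unifChar M t‖ ≤ 1 - (M * t) ^ 2 / 18 := by
  have hM' : (2 : ℝ) ≤ M := by exact_mod_cast hM
  have hpi := Real.pi_pos
  have hMt : (M * t) ^ 2 ≤ 1 := by
    rw [← sq_abs, abs_mul, Nat.abs_cast]
    nlinarith [mul_nonneg (Nat.cast_nonneg (α := ℝ) M) (abs_nonneg t)]
  have hsq : ‖∑ m ∈ Finset.range M,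
      Complex.exp (((2 * π * (m + 1) * t : ℝ) : ℂ) * Complex.I)‖ ^ 2 ≤
      (M : ℝ) ^ 2 * (1 - (M * t) ^ 2 / 9) := by
    rw [norm_sum_exp_sq (Finset.range M) (fun m => 2 * π * (m + 1) * t)]
    have hterm : ∀ m ∈ Finset.range M, ∀ k ∈ Finset.range M,
        Real.cos (2 * π * (m + 1) * t - 2 * π * (k + 1) * t) ≤
          1 - 8 / 9 * t ^ 2 * ((m : ℝ) - k) ^ 2 := by
      intro m hm k hk
      have hm' : (m : ℝ) < M := by exact_mod_cast Finset.mem_range.1 hm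
      have hk' : (k : ℝ) < M := by exact_mod_cast Finset.mem_range.1 hk
      have e : 2 * π * (m + 1) * t - 2 * π * (k + 1) * t = 2 * π * (((m : ℝ) - k) * t) := by ring
      rw [e]
      refine (cos_le_one_sub_mul_sq ?_).trans_eq ?_
      · rw [abs_mul (2 * π), abs_mul ((m : ℝ) - k), abs_of_pos (by positivity : 0 < 2 * π)]
        have h1 : |(m : ℝ) - k| ≤ M := by
          rw [abs_le]
          constructor <;> linarith [Nat.cast_nonneg (α := ℝ) m, Nat.cast_nonneg (α := ℝ) k]
        have : |(m : ℝ) - k| * |t| ≤ 3 / 4 := le_trans (by gcongr) ht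
        nlinarith
      · field_simp
        ring
    refine (Finset.sum_le_sum fun m hm => Finset.sum_le_sum (hterm m hm)).trans ?_
    simp only [Finset.sum_sub_distrib, ← Finset.mul_sum, sum_sum_range_sub_sq]
    simp only [Finset.sum_const, Finset.card_range, nsmul_eq_mul, mul_one]
    have h34 : 3 / 4 * (M : ℝ) ^ 2 ≤ (M : ℝ) ^ 2 - 1 := by nlinarith
    have : t ^ 2 * (M : ℝ) ^ 2 * (3 / 4 * (M : ℝ) ^ 2) ≤
        t ^ 2 * (M : ℝ) ^ 2 * ((M : ℝ) ^ 2 - 1) := by gcongr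
    nlinarith
  unfold unifChar
  rw [norm_div, Complex.norm_natCast, div_le_iff₀ (by linarith)]
  refine abs_le_of_sq_le_sq' ?_ ?_ |>.2
  · refine hsq.trans ?_
    have h1 : 1 - (M * t) ^ 2 / 9 ≤ (1 - (M * t) ^ 2 / 18) ^ 2 := by
      nlinarith [sq_nonneg ((M * t) ^ 2)]
    calc (M : ℝ) ^ 2 * (1 - (M * t) ^ 2 / 9)
        ≤ (M : ℝ) ^ 2 * (1 - (M * t) ^ 2 / 18) ^ 2 := by gcongr
      _ = ((1 - (M * t) ^ 2 / 18) * M) ^ 2 := by ring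
  · nlinarith

lemma norm_unifChar_le_two_thirds {M : ℕ} {t : ℝ}
    (ht : 3 / 4 ≤ M * ‖(t : UnitAddCircle)‖) : ‖unifChar M t‖ ≤ 2 / 3 := by
  have := norm_unifChar_mul_le_one M t
  nlinarith [norm_nonneg (unifChar M t)]

/-- Uniform quadratic decay of the characteristic function on the scale `1 / M`. -/
lemma exists_norm_unifChar_le (K : ℝ) : ∃ c > 0, ∀ M : ℕ, 2 ≤ M → 2 * K ≤ M →
    ∀ s : ℝ, |s| ≤ K → ‖unifChar M (s / M)‖ ≤ 1 - c * s ^ 2 := by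
  refine ⟨min (1 / 18) (1 / (3 * (K ^ 2 + 1))), by positivity, fun M hM hKM s hs => ?_⟩
  have hM' : (0 : ℝ) < M := by exact_mod_cast (by omega : 0 < M)
  rcases le_total |s| (3 / 4) with h | h
  · refine (norm_unifChar_le_of_mul_le hM ?_).trans ?_
    · rwa [abs_div, Nat.abs_cast, mul_div_cancel₀ _ hM'.ne']
    · rw [mul_div_cancel₀ _ hM'.ne']
      have : min (1 / 18) (1 / (3 * (K ^ 2 + 1))) * s ^ 2 ≤ 1 / 18 * s ^ 2 := by
        gcongr
        exact min_le_left _ _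
      linarith
  · refine (norm_unifChar_le_two_thirds ?_).trans ?_
    · have : ‖((s / M : ℝ) : UnitAddCircle)‖ = |s / M| := by
        refine (AddCircle.norm_coe_eq_abs_iff (p := 1) one_ne_zero).2 ?_
        rw [abs_div, Nat.abs_cast, abs_one, div_le_iff₀ hM']
        linarith
      rwa [this, abs_div, Nat.abs_cast, mul_div_cancel₀ _ hM'.ne']
    · have h1 : min (1 / 18) (1 / (3 * (K ^ 2 + 1))) * s ^ 2 ≤ 1 / (3 * (K ^ 2 + 1)) * K ^ 2 := by
        have : s ^ 2 ≤ K ^ 2 := by rw [← sq_abs]; gcongr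
        gcongr
        exact min_le_right _ _
      have h2 : 1 / (3 * (K ^ 2 + 1)) * K ^ 2 ≤ 1 / 3 := by
        rw [div_mul_eq_mul_div, div_le_div_iff₀ (by positivity) (by norm_num)]
        nlinarith
      linarith

lemma norm_exp_mul_I_sub_le (z : ℝ) :
    ‖Complex.exp ((z : ℂ) * Complex.I) - (1 + z * Complex.I - (z : ℂ) ^ 2 / 2)‖ ≤
      |z| ^ 3 * Real.exp |z| := by
  have h := Complex.norm_exp_sub_sum_le_norm_mul_exp ((z : ℂ) * Complex.I) 3
  rw [norm_mul, Complex.norm_I, mul_one, Complex.norm_real, Real.norm_eq_abs] at h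
  convert h using 3
  simp [Finset.sum_range_succ, Nat.factorial, mul_pow]
  ring

/-- Second-order Taylor expansion of the characteristic function. -/
lemma norm_unifChar_sub_le {M : ℕ} (hM : 1 ≤ M) (t : ℝ) :
    ‖unifChar M t - (1 + ((π * (M + 1) * t : ℝ) : ℂ) * Complex.I -
      ((π ^ 2 * ((M + 1) * (2 * M + 1)) / 3 * t ^ 2 : ℝ) : ℂ))‖ ≤
      (2 * π * (M * |t|)) ^ 3 * Real.exp (2 * π * (M * |t|)) := by
  have hM' : (0 : ℝ) < M := by exact_mod_cast hM
  have hMc : (M : ℂ) ≠ 0 := by exact_mod_cast hM'.ne'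
  have hpi := Real.pi_pos
  have e : unifChar M t - (1 + ((π * (M + 1) * t : ℝ) : ℂ) * Complex.I -
      ((π ^ 2 * ((M + 1) * (2 * M + 1)) / 3 * t ^ 2 : ℝ) : ℂ)) =
      (∑ m ∈ Finset.range M, (Complex.exp (((2 * π * (m + 1) * t : ℝ) : ℂ) * Complex.I) -
        (1 + ((2 * π * (m + 1) * t : ℝ) : ℂ) * Complex.I -
          ((2 * π * (m + 1) * t : ℝ) : ℂ) ^ 2 / 2))) / M := by
    have h1 : ∑ m ∈ Finset.range M, (m : ℂ) = M * (M - 1) / 2 := by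
      simpa using congrArg Complex.ofReal (sum_range_cast M)
    have h2 : ∑ m ∈ Finset.range M, (m : ℂ) ^ 2 = M * (M - 1) * (2 * M - 1) / 6 := by
      simpa using congrArg Complex.ofReal (sum_range_cast_sq M)
    have h3 : ∑ m ∈ Finset.range M, (1 + ((2 * π * (m + 1) * t : ℝ) : ℂ) * Complex.I -
          ((2 * π * (m + 1) * t : ℝ) : ℂ) ^ 2 / 2) =
        M * (1 + ((π * (M + 1) * t : ℝ) : ℂ) * Complex.I -
      ((π ^ 2 * ((M + 1) * (2 * M + 1)) / 3 * t ^ 2 : ℝ) : ℂ)) := by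
      have : ∀ m : ℕ, (1 + ((2 * π * (m + 1) * t : ℝ) : ℂ) * Complex.I -
          ((2 * π * (m + 1) * t : ℝ) : ℂ) ^ 2 / 2) =
          (1 + 2 * π * t * Complex.I - 2 * π ^ 2 * t ^ 2) +
          (2 * π * t * Complex.I - 4 * π ^ 2 * t ^ 2) * m - 2 * π ^ 2 * t ^ 2 * (m : ℂ) ^ 2 := by
        intro m
        push_cast
        ring
      simp only [this, Finset.sum_add_distrib, Finset.sum_sub_distrib, ← Finset.mul_sum, h1, h2,
        Finset.sum_const, Finset.card_range, nsmul_eq_mul]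
      push_cast
      ring
    rw [Finset.sum_sub_distrib, h3, sub_div, mul_div_cancel_left₀ _ hMc, unifChar]
  rw [e, norm_div, Complex.norm_natCast, div_le_iff₀ hM']
  refine (norm_sum_le _ _).trans ?_
  refine (Finset.sum_le_card_nsmul _ _
    ((2 * π * (M * |t|)) ^ 3 * Real.exp (2 * π * (M * |t|))) ?_).trans_eq ?_
  · intro m hm
    refine (norm_exp_mul_I_sub_le _).trans ?_
    have hm' : (m : ℝ) + 1 ≤ M := by exact_mod_cast Finset.mem_range.1 hm
    have : |2 * π * (m + 1) * t| ≤ 2 * π * (M * |t|) := by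
      rw [abs_mul, abs_of_pos (by positivity : 0 < 2 * π * ((m : ℝ) + 1)), ← mul_assoc]
      gcongr
    gcongr
  · rw [Finset.card_range, nsmul_eq_mul, mul_comm]

section Walk

variable {I J : Type*} [Fintype J]

/-- The linear form attached to the `i`-th row of an integer matrix. -/
noncomputable def rowForm (c : Matrix I J ℤ) (i : I) (x : J → ℝ) : ℝ := ∑ j, (c i j : ℝ) * x j

lemma continuous_rowForm (c : Matrix I J ℤ) (i : I) : Continuous (rowForm c i) := by
  unfold rowForm
  fun_prop

lemma rowForm_smul (c : Matrix I J ℤ) (i : I) (r : ℝ) (x : J → ℝ) :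
    rowForm c i (r • x) = r * rowForm c i x := by
  simp only [rowForm, Pi.smul_apply, smul_eq_mul, Finset.mul_sum]
  exact Finset.sum_congr rfl fun j _ => by ring

lemma coe_rowForm (c : Matrix I J ℤ) (i : I) (x : J → ℝ) :
    ((rowForm c i x : ℝ) : UnitAddCircle) = ∑ j, c i j • (x j : UnitAddCircle) := by
  unfold rowForm
  have := map_sum (QuotientAddGroup.mk' (AddSubgroup.zmultiples (1 : ℝ)))
    (fun j => (c i j : ℝ) * x j) Finset.univ
  refine this.trans (Finset.sum_congr rfl fun j _ => ?_)
  rw [← zsmul_eq_mul]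
  exact map_zsmul (QuotientAddGroup.mk' (AddSubgroup.zmultiples (1 : ℝ))) _ _

variable [Fintype I]

/-- The characteristic function of the step `X • c i`, where `X` is uniform on `{1,…,M}` and the
row `i` is uniform. -/
noncomputable def stepChar (c : Matrix I J ℤ) (M : ℕ) (x : J → ℝ) : ℂ :=
  (∑ i, unifChar M (rowForm c i x)) / Fintype.card I

lemma continuous_stepChar (c : Matrix I J ℤ) (M : ℕ) : Continuous (stepChar c M) := by
  unfold stepChar
  have := fun i => (continuous_unifChar M).comp (continuous_rowForm c i)
  exact (continuous_finsetSum _ fun i _ => this i).div_const _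

lemma sum_rowForm_eq_zero {c : Matrix I J ℤ} (hc : ∀ j, ∑ i, c i j = 0) (x : J → ℝ) :
    ∑ i, rowForm c i x = 0 := by
  simp only [rowForm]
  rw [Finset.sum_comm]
  refine Finset.sum_eq_zero fun j _ => ?_
  rw [← Finset.sum_mul]
  have : ∑ i, (c i j : ℝ) = 0 := by exact_mod_cast congrArg (fun z : ℤ => (z : ℝ)) (hc j)
  rw [this, zero_mul]

lemma norm_stepChar_le [Nonempty I] (c : Matrix I J ℤ) (M : ℕ) (x : J → ℝ) {r : ℝ}
    (h : ∑ i, ‖unifChar M (rowForm c i x)‖ ≤ Fintype.card I * r) : ‖stepChar c M x‖ ≤ r := by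
  unfold stepChar
  rw [norm_div, Complex.norm_natCast, div_le_iff₀ (by exact_mod_cast Fintype.card_pos), mul_comm]
  exact (norm_sum_le _ _).trans h

/-- The coordinates are controlled by the row forms when the rows generate `ℤ^J`. -/
lemma norm_le_of_norm_row_le [DecidableEq J] {c : Matrix I J ℤ} {A : Matrix J I ℤ} (hA : A * c = 1)
    {E : Type*} [SeminormedAddCommGroup E] (g : J → E) {r : ℝ}
    (h : ∀ i, ‖∑ j, c i j • g j‖ ≤ r) (j : J) : ‖g j‖ ≤ (∑ j, ∑ i, |(A j i : ℝ)|) * r := by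
  have e : g j = ∑ i, A j i • ∑ k, c i k • g k := by
    simp only [Finset.smul_sum, smul_smul]
    rw [Finset.sum_comm]
    simp only [← Finset.sum_smul]
    have : ∀ k, ∑ i, A j i * c i k = (1 : Matrix J J ℤ) j k := fun k => by
      rw [← hA, Matrix.mul_apply]
    simp [this, Matrix.one_apply]
  have hr : ∑ i, |(A j i : ℝ)| * r ≤ (∑ j, ∑ i, |(A j i : ℝ)|) * r := by
    rw [Finset.sum_mul]
    simp_rw [Finset.sum_mul]
    refine Finset.single_le_sum (f := fun j => ∑ i, |(A j i : ℝ)| * r) (fun k _ => ?_)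
      (Finset.mem_univ j)
    exact Finset.sum_nonneg fun i _ => mul_nonneg (abs_nonneg _) ((norm_nonneg _).trans (h i))
  rw [e]
  refine (norm_sum_le _ _).trans (le_trans (Finset.sum_le_sum fun i _ => ?_) hr)
  refine (norm_zsmul_le _ _).trans ?_
  rw [Int.norm_eq_abs]
  exact mul_le_mul_of_nonneg_left (h i) (abs_nonneg _)

/-- Away from the origin of the torus, at least two of the summands of `stepChar` are small. -/
lemma exists_norm_stepChar_le_of_far [DecidableEq J] [Nonempty I] {c : Matrix I J ℤ}
    {A : Matrix J I ℤ} (hA : A * c = 1) (hc : ∀ j, ∑ i, c i j = 0) :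
    ∃ C > 0, ∀ (M : ℕ) (K : ℝ), 1 ≤ M → 0 < K → ∀ x : J → ℝ,
      (∃ j, K ≤ M * ‖(x j : UnitAddCircle)‖) →
      ‖stepChar c M x‖ ≤ 1 - 2 / Fintype.card I + C / K := by
  classical
  set q : ℝ := (Fintype.card I : ℝ) with hq
  have hq0 : 0 < q := by rw [hq]; exact_mod_cast Fintype.card_pos
  set S : ℝ := ∑ j, ∑ i, |(A j i : ℝ)| with hS
  have hS0 : 0 ≤ S := by positivity
  refine ⟨S + 1, by positivity, fun M K hM hK x ⟨j, hj⟩ => ?_⟩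
  have hM' : (0 : ℝ) < M := by exact_mod_cast hM
  set ℓ : I → UnitAddCircle := fun i => ((rowForm c i x : ℝ) : UnitAddCircle) with hℓ
  set r := K / ((S + 1) * M) with hr
  have hr0 : 0 < r := by positivity
  obtain ⟨i, hi⟩ : ∃ i, r < ‖ℓ i‖ := by
    by_contra! hcon
    have h1 := norm_le_of_norm_row_le hA (fun j => (x j : UnitAddCircle)) (r := r)
      (fun i => by rw [← coe_rowForm]; exact hcon i) j
    have h2 : M * ((S + 1) * r) = K := by rw [hr]; field_simp
    have h3 : M * ‖(x j : UnitAddCircle)‖ ≤ M * (S * r) := by gcongr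
    nlinarith [mul_pos hM' hr0]
  have hsum : ∑ k, ℓ k = 0 := by
    have h1 := map_sum (QuotientAddGroup.mk' (AddSubgroup.zmultiples (1 : ℝ)))
      (fun i => rowForm c i x) Finset.univ
    rw [sum_rowForm_eq_zero hc, map_zero] at h1
    exact h1.symm
  obtain ⟨k, hki, hk⟩ : ∃ k, k ≠ i ∧ r / q < ‖ℓ k‖ := by
    by_contra! hcon
    have h1 : ℓ i = -∑ k ∈ Finset.univ.erase i, ℓ k := by
      rw [← Finset.add_sum_erase _ _ (Finset.mem_univ i)] at hsum
      exact eq_neg_of_add_eq_zero_left hsum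
    have h2 : ‖ℓ i‖ ≤ ∑ k ∈ Finset.univ.erase i, r / q := by
      rw [h1, norm_neg]
      exact (norm_sum_le _ _).trans
        (Finset.sum_le_sum fun k hk => hcon k (Finset.ne_of_mem_erase hk))
    have h3 : ∑ k ∈ Finset.univ.erase i, r / q ≤ ∑ k : I, r / q :=
      Finset.sum_le_sum_of_subset_of_nonneg (Finset.erase_subset _ _) fun _ _ _ => by positivity
    have h4 : ∑ k : I, r / q = r := by
      rw [Finset.sum_const, Finset.card_univ, nsmul_eq_mul, ← hq, mul_div_cancel₀ _ hq0.ne']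
    linarith
  have hq1 : 1 ≤ q := by
    rw [hq]; exact_mod_cast Nat.one_le_iff_ne_zero.2 Fintype.card_ne_zero
  have small : ∀ m, r / q < ‖ℓ m‖ → ‖unifChar M (rowForm c m x)‖ ≤ q * (S + 1) / (2 * K) := by
    intro m hm
    have h1 := norm_unifChar_mul_le_one M (rowForm c m x)
    have h2 : ‖unifChar M (rowForm c m x)‖ * (2 * M * (r / q)) ≤ 1 :=
      le_trans (by gcongr) h1
    have h3 : 2 * M * (r / q) = 2 * K / (q * (S + 1)) := by rw [hr]; field_simp
    rw [h3] at h2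
    rw [le_div_iff₀ (by positivity)]
    rwa [mul_div_assoc', div_le_one (by positivity)] at h2
  have hsi := small i (lt_of_le_of_lt (div_le_self hr0.le hq1) hi)
  have hsk := small k hk
  refine norm_stepChar_le c M x ?_
  rw [← Finset.add_sum_erase _ _ (Finset.mem_univ i),
    ← Finset.add_sum_erase _ _ (Finset.mem_erase.2 ⟨hki, Finset.mem_univ k⟩)]
  have hcard : ((((Finset.univ : Finset I).erase i).erase k).card : ℝ) = q - 2 := by
    have h1 := Finset.card_erase_add_one (Finset.mem_erase.2 ⟨hki, Finset.mem_univ k⟩)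
    have h2 := Finset.card_erase_add_one (Finset.mem_univ i)
    rw [Finset.card_univ] at h2
    rw [hq, ← h2, ← h1]
    push_cast
    ring
  have hrest : ∑ m ∈ ((Finset.univ : Finset I).erase i).erase k,
      ‖unifChar M (rowForm c m x)‖ ≤ q - 2 := by
    rw [← hcard]
    refine (Finset.sum_le_card_nsmul _ _ 1 fun m _ => norm_unifChar_le_one _ _).trans_eq ?_
    simp
  rw [← hq]
  have e : q * (1 - 2 / q + (S + 1) / K) =
      q * (S + 1) / (2 * K) + (q * (S + 1) / (2 * K) + (q - 2)) := by
    field_simp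
    ring
  rw [e]
  gcongr

/-- Gaussian domination of `stepChar` near the origin. -/
lemma exists_norm_stepChar_le_of_near [DecidableEq J] [Nonempty I] {c : Matrix I J ℤ}
    {A : Matrix J I ℤ} (hA : A * c = 1) (K : ℝ) :
    ∃ b > 0, ∃ M₀ : ℕ, 1 ≤ M₀ ∧ ∀ M : ℕ, M₀ ≤ M → ∀ u : J → ℝ, (∀ j, |u j| ≤ K) →
      ‖stepChar c M ((M : ℝ)⁻¹ • u)‖ ≤ Real.exp (-(b * ∑ j, u j ^ 2)) := by
  classical
  set q : ℝ := (Fintype.card I : ℝ) with hq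
  have hq0 : 0 < q := by rw [hq]; exact_mod_cast Fintype.card_pos
  set S : ℝ := ∑ j, ∑ i, |(A j i : ℝ)| with hS
  have hS0 : 0 ≤ S := by positivity
  set T : ℝ := ∑ i, ∑ j, |(c i j : ℝ)| with hT
  obtain ⟨c₀, hc₀, H⟩ := exists_norm_unifChar_le (T * K)
  set d : ℝ := (Fintype.card J : ℝ) with hd
  refine ⟨c₀ / (q * (S ^ 2 * d + 1)), by positivity, max 2 ⌈2 * (T * K)⌉₊,
    le_trans one_le_two (le_max_left _ _), fun M hM u hu => ?_⟩
  have hM2 : 2 ≤ M := (le_max_left _ _).trans hM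
  have hMK : 2 * (T * K) ≤ M := (Nat.le_ceil _).trans
    (by exact_mod_cast (le_max_right _ _).trans hM)
  have hrow : ∀ i, |rowForm c i u| ≤ T * K := by
    intro i
    unfold rowForm
    refine (Finset.abs_sum_le_sum_abs _ _).trans ?_
    have hK : ∀ j, 0 ≤ |(c i j : ℝ)| * K := fun j =>
      mul_nonneg (abs_nonneg _) ((abs_nonneg _).trans (hu j))
    calc ∑ j, |(c i j : ℝ) * u j| ≤ ∑ j, |(c i j : ℝ)| * K :=
          Finset.sum_le_sum fun j _ => by rw [abs_mul]; gcongr; exact hu j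
      _ ≤ ∑ i, ∑ j, |(c i j : ℝ)| * K :=
          Finset.single_le_sum (f := fun i => ∑ j, |(c i j : ℝ)| * K)
            (fun k _ => Finset.sum_nonneg fun j _ =>
              mul_nonneg (abs_nonneg _) ((abs_nonneg _).trans (hu j))) (Finset.mem_univ i)
      _ = T * K := by rw [hT]; simp only [Finset.sum_mul]
  have hquad : ∑ j, u j ^ 2 ≤ (S ^ 2 * d + 1) * ∑ i, rowForm c i u ^ 2 := by
    set Q := ∑ i, rowForm c i u ^ 2 with hQ
    have hQ0 : 0 ≤ Q := by positivity
    have h1 : ∀ j, |u j| ≤ S * Real.sqrt Q := by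
      refine norm_le_of_norm_row_le hA (fun j => u j) fun i => ?_
      have h2 : ∑ j, c i j • u j = rowForm c i u := by
        unfold rowForm
        simp only [zsmul_eq_mul]
      rw [h2, Real.norm_eq_abs]
      refine Real.le_sqrt_of_sq_le ?_
      rw [sq_abs]
      exact Finset.single_le_sum (f := fun i => rowForm c i u ^ 2) (fun _ _ => sq_nonneg _)
        (Finset.mem_univ i)
    have h3 : ∀ j, u j ^ 2 ≤ S ^ 2 * Q := fun j => by
      calc u j ^ 2 = |u j| ^ 2 := (sq_abs _).symm
        _ ≤ (S * Real.sqrt Q) ^ 2 := by gcongr; exact h1 j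
        _ = S ^ 2 * Q := by rw [mul_pow, Real.sq_sqrt hQ0]
    calc ∑ j, u j ^ 2 ≤ ∑ _j : J, S ^ 2 * Q := Finset.sum_le_sum fun j _ => h3 j
      _ = d * (S ^ 2 * Q) := by simp [hd]
      _ ≤ (S ^ 2 * d + 1) * Q := by nlinarith
  refine le_trans (norm_stepChar_le c M _ (r := 1 - c₀ / q * ∑ i, rowForm c i u ^ 2) ?_) ?_
  · calc ∑ i, ‖unifChar M (rowForm c i ((M : ℝ)⁻¹ • u))‖
        ≤ ∑ i, (1 - c₀ * rowForm c i u ^ 2) := Finset.sum_le_sum fun i _ => by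
          rw [rowForm_smul, inv_mul_eq_div]
          exact H M hM2 hMK _ (hrow i)
      _ = q * (1 - c₀ / q * ∑ i, rowForm c i u ^ 2) := by
          rw [Finset.sum_sub_distrib, ← Finset.mul_sum]
          simp only [Finset.sum_const, Finset.card_univ, nsmul_eq_mul, mul_one, ← hq]
          field_simp
  · refine le_trans ?_ (Real.one_sub_le_exp_neg _)
    have : c₀ / (q * (S ^ 2 * d + 1)) * ∑ j, u j ^ 2 ≤ c₀ / q * ∑ i, rowForm c i u ^ 2 := by
      calc c₀ / (q * (S ^ 2 * d + 1)) * ∑ j, u j ^ 2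
          ≤ c₀ / (q * (S ^ 2 * d + 1)) * ((S ^ 2 * d + 1) * ∑ i, rowForm c i u ^ 2) := by gcongr
        _ = c₀ / q * ∑ i, rowForm c i u ^ 2 := by
            have : S ^ 2 * d + 1 ≠ 0 := by positivity
            field_simp
    linarith

end Walk

lemma tendsto_mul_pow_mul_pow_zero {M : ℕ → ℕ} (hM1 : ∀ n, 1 ≤ M n) {κ : ℝ}
    (hκ : Tendsto (fun n : ℕ => (n : ℝ) / Real.log (M n)) atTop (𝓝 κ)) {d : ℕ} {ρ : ℝ}
    (hρ : 0 < ρ) (h : d < κ * -Real.log ρ) :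
    Tendsto (fun n : ℕ => ((M n : ℝ) * √n) ^ d * ρ ^ n) atTop (𝓝 0) := by
  have hκ0 : 0 ≤ κ := ge_of_tendsto' hκ fun n => div_nonneg (Nat.cast_nonneg _)
    (Real.log_nonneg (by exact_mod_cast hM1 n))
  have hκpos : 0 < κ := by
    refine lt_of_le_of_ne hκ0 fun h0 => ?_
    rw [← h0, zero_mul] at h
    exact absurd h (not_lt.2 (Nat.cast_nonneg _))
  have hinv : Tendsto (fun n : ℕ => Real.log (M n) / n) atTop (𝓝 κ⁻¹) := by
    simpa only [inv_div] using hκ.inv₀ hκpos.ne'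
  have hlog : Tendsto (fun n : ℕ => Real.log n / n) atTop (𝓝 0) :=
    (Real.isLittleO_log_id_atTop.tendsto_div_nhds_zero).comp tendsto_natCast_atTop_atTop
  have hlim : Tendsto (fun n : ℕ => d * (Real.log (M n) / n) + d / 2 * (Real.log n / n) +
      Real.log ρ) atTop (𝓝 (d * κ⁻¹ + d / 2 * 0 + Real.log ρ)) :=
    ((hinv.const_mul _).add (hlog.const_mul _)).add_const _
  have hneg : d * κ⁻¹ + d / 2 * 0 + Real.log ρ < 0 := by
    have : d * κ⁻¹ < -Real.log ρ := by
      rw [← div_eq_mul_inv, div_lt_iff₀ hκpos]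
      linarith
    linarith
  have hbot := (tendsto_natCast_atTop_atTop (R := ℝ)).atTop_mul_neg hneg hlim
  refine (Real.tendsto_exp_atBot.comp hbot).congr' ?_
  filter_upwards [eventually_ge_atTop 1] with n hn
  have hn' : (0 : ℝ) < n := by exact_mod_cast hn
  have hM' : (0 : ℝ) < M n := by exact_mod_cast hM1 n
  have e : ((M n : ℝ) * √n) ^ d * ρ ^ n =
      Real.exp (Real.log (((M n : ℝ) * √n) ^ d * ρ ^ n)) := (Real.exp_log (by positivity)).symm
  rw [e, Real.log_mul (by positivity) (by positivity), Real.log_pow, Real.log_pow,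
    Real.log_mul (by positivity) (by positivity), Real.log_sqrt hn'.le]
  simp only [Function.comp]
  congr 1
  field_simp

section Fourier

lemma integral_exp_int_mul (v : ℤ) :
    ∫ x in Set.Ioc (-(1 / 2) : ℝ) (1 / 2), Complex.exp (((2 * π * (v * x) : ℝ) : ℂ) * Complex.I) =
      if v = 0 then 1 else 0 := by
  rw [← intervalIntegral.integral_of_le (by norm_num)]
  split_ifs with hv
  · subst hv
    norm_num
  · have hc : (2 * π * v * Complex.I : ℂ) ≠ 0 := by
      simp [hv, Real.pi_ne_zero]
    have e : ∀ x : ℝ, Complex.exp (((2 * π * (v * x) : ℝ) : ℂ) * Complex.I) =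
        Complex.exp ((2 * π * v * Complex.I : ℂ) * x) := fun x => by
      congr 1
      push_cast
      ring
    simp only [e]
    rw [integral_exp_mul_complex hc, div_eq_zero_iff]
    left
    rw [sub_eq_zero, Complex.exp_eq_exp_iff_exists_int]
    refine ⟨v, ?_⟩
    push_cast
    ring

variable {I J : Type*} [Fintype I] [Fintype J]

/-- The fundamental domain of the torus `ℝ^J / ℤ^J` centred at the origin. -/
def centredBox (J : Type*) : Set (J → ℝ) := Set.univ.pi fun _ => Set.Ioc (-(1 / 2)) (1 / 2)

lemma volume_centredBox : volume (centredBox J) = 1 := by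
  rw [centredBox, volume_pi_pi]
  norm_num [Real.volume_Ioc]

lemma integrableOn_centredBox {f : (J → ℝ) → ℂ} (hf : Continuous f) :
    IntegrableOn f (centredBox J) := by
  have hc : IsCompact (Set.univ.pi fun _ : J => Set.Icc (-(1 / 2) : ℝ) (1 / 2)) :=
    isCompact_univ_pi fun _ => isCompact_Icc
  exact (hf.continuousOn.integrableOn_compact hc).mono_set
    (Set.pi_mono fun _ _ => Set.Ioc_subset_Icc_self)

lemma integral_centredBox_exp (v : J → ℤ) :
    ∫ x in centredBox J, Complex.exp (((2 * π * ∑ j, v j * x j : ℝ) : ℂ) * Complex.I) =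
      if ∀ j, v j = 0 then 1 else 0 := by
  have e : ∀ x : J → ℝ, Complex.exp (((2 * π * ∑ j, v j * x j : ℝ) : ℂ) * Complex.I) =
      ∏ j, Complex.exp (((2 * π * (v j * x j) : ℝ) : ℂ) * Complex.I) := fun x => by
    rw [← Complex.exp_sum, ← Finset.sum_mul, Finset.mul_sum, Complex.ofReal_sum]
  simp only [e]
  rw [centredBox, volume_pi, Measure.restrict_pi_pi,
    integral_fintype_prod_eq_prod (fun j (y : ℝ) =>
      Complex.exp (((2 * π * (v j * y) : ℝ) : ℂ) * Complex.I))]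
  simp only [integral_exp_int_mul]
  rw [Finset.prod_ite_zero]
  simp

/-- The number of `n`-step walks with steps `m • c i`, `1 ≤ m ≤ M`, that return to the origin. -/
def zeroSumCount (c : Matrix I J ℤ) (n M : ℕ) : ℕ :=
  (Finset.univ.filter fun p : Fin n → Fin M × I =>
    ∀ j, ∑ t, (((p t).1 : ℕ) + 1 : ℤ) * c (p t).2 j = 0).card

lemma stepChar_pow (c : Matrix I J ℤ) (n M : ℕ) (x : J → ℝ) :
    stepChar c M x ^ n = (∑ p : Fin n → Fin M × I, Complex.exp (((2 * π *
      ∑ j, ((∑ t, (((p t).1 : ℕ) + 1 : ℤ) * c (p t).2 j : ℤ) : ℝ) * x j : ℝ) : ℂ) * Complex.I)) /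
        ((M : ℂ) ^ n * (Fintype.card I : ℂ) ^ n) := by
  have h1 : stepChar c M x = (∑ a : Fin M × I, Complex.exp
      (((2 * π * (((a.1 : ℕ) : ℝ) + 1) * rowForm c a.2 x : ℝ) : ℂ) * Complex.I)) /
        (M * Fintype.card I) := by
    unfold stepChar unifChar
    rw [← Finset.sum_div, div_div, Fintype.sum_prod_type_right]
    congr 1
    refine Finset.sum_congr rfl fun i _ => ?_
    rw [Finset.sum_range]
  rw [h1, div_pow, mul_pow, Fintype.sum_pow]
  congr 1
  refine Finset.sum_congr rfl fun p _ => ?_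
  rw [← Complex.exp_sum, ← Finset.sum_mul, ← Complex.ofReal_sum]
  congr 4
  have e : ∑ j, ((∑ t, (((p t).1 : ℕ) + 1 : ℤ) * c (p t).2 j : ℤ) : ℝ) * x j =
      ∑ t, (((p t).1 : ℕ) + 1 : ℝ) * rowForm c (p t).2 x := by
    unfold rowForm
    push_cast
    simp only [Finset.sum_mul, Finset.mul_sum]
    rw [Finset.sum_comm]
    exact Finset.sum_congr rfl fun _ _ => Finset.sum_congr rfl fun _ _ => by ring
  rw [e, Finset.mul_sum]
  exact Finset.sum_congr rfl fun _ _ => by ring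

/-- Fourier inversion for the return probability. -/
lemma integral_stepChar_pow (c : Matrix I J ℤ) (n M : ℕ) :
    ∫ x in centredBox J, stepChar c M x ^ n =
      (zeroSumCount c n M : ℂ) / ((M : ℂ) ^ n * (Fintype.card I : ℂ) ^ n) := by
  simp only [stepChar_pow]
  rw [integral_div, integral_finsetSum]
  · simp only [integral_centredBox_exp]
    rw [Finset.sum_boole, zeroSumCount]
  · intro p _
    exact integrableOn_centredBox (by fun_prop)

end Fourier

section Asymptotics

variable {I J : Type*} [Fintype I] [Fintype J]

lemma tendsto_stepChar_pow [Nonempty I] {c : Matrix I J ℤ} (hc : ∀ j, ∑ i, c i j = 0) {M : ℕ → ℕ}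
    (hM1 : ∀ n, 1 ≤ M n) (hM : Tendsto M atTop atTop) (y : J → ℝ) :
    Tendsto (fun n : ℕ => stepChar c (M n) (((M n : ℝ) * √n)⁻¹ • y) ^ n) atTop
      (𝓝 (Complex.exp ((-(2 * π ^ 2 / (3 * Fintype.card I) * ∑ i, rowForm c i y ^ 2) : ℝ) : ℂ))) := by
  set q : ℝ := (Fintype.card I : ℝ) with hq
  have hq0 : 0 < q := by rw [hq]; exact_mod_cast Fintype.card_pos
  set Q := ∑ i, rowForm c i y ^ 2 with hQ
  have key : Tendsto (fun n : ℕ => (n : ℂ) * (stepChar c (M n) (((M n : ℝ) * √n)⁻¹ • y) - 1)) atTop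
      (𝓝 ((-(2 * π ^ 2 / (3 * q) * Q) : ℝ) : ℂ)) := by
    set w : ℕ → ℝ := fun n => -(π ^ 2 / (3 * q) * ((1 + (M n : ℝ)⁻¹) * (2 + (M n : ℝ)⁻¹)) * Q) with hw
    have hMinv : Tendsto (fun n => (M n : ℝ)⁻¹) atTop (𝓝 0) :=
      tendsto_inv_atTop_zero.comp (tendsto_natCast_atTop_atTop.comp hM)
    have hwlim : Tendsto w atTop (𝓝 (-(2 * π ^ 2 / (3 * q) * Q))) := by
      have h1 := ((((hMinv.const_add 1).mul (hMinv.const_add 2)).const_mul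
        (π ^ 2 / (3 * q))).mul_const Q).neg
      convert h1 using 2
      ring
    have hwc : Tendsto (fun n => (w n : ℂ)) atTop (𝓝 ((-(2 * π ^ 2 / (3 * q) * Q) : ℝ) : ℂ)) :=
      (Complex.continuous_ofReal.tendsto _).comp hwlim
    set B : ℝ := (∑ i, (2 * π * |rowForm c i y|) ^ 3 * Real.exp (2 * π * |rowForm c i y|)) / q with hB
    have hbound : ∀ᶠ n : ℕ in atTop,
        ‖(n : ℂ) * (stepChar c (M n) (((M n : ℝ) * √n)⁻¹ • y) - 1) - w n‖ ≤ B * (√n)⁻¹ := by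
      filter_upwards [eventually_ge_atTop 1] with n hn
      have hn' : (1 : ℝ) ≤ n := by exact_mod_cast hn
      have hs : 1 ≤ √(n : ℝ) := Real.one_le_sqrt.2 hn'
      have hs0 : 0 < √(n : ℝ) := by linarith
      have hss : (n : ℝ) * ((√n)⁻¹) ^ 2 = 1 := by
        rw [inv_pow, Real.sq_sqrt (by linarith), mul_inv_cancel₀ (by linarith)]
      have hm : (0 : ℝ) < M n := by exact_mod_cast hM1 n
      set r : ℝ := ((M n : ℝ) * √n)⁻¹ with hr
      have hMr : (M n : ℝ) * r = (√n)⁻¹ := by rw [hr]; field_simp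
      set a : I → ℂ := fun i => unifChar (M n) (r * rowForm c i y) -
        (1 + ((π * (M n + 1) * (r * rowForm c i y) : ℝ) : ℂ) * Complex.I -
      ((π ^ 2 * ((M n + 1) * (2 * M n + 1)) / 3 * (r * rowForm c i y) ^ 2 : ℝ) : ℂ)) with ha
      have hai : ∀ i, ‖a i‖ ≤ (2 * π * |rowForm c i y|) ^ 3 * Real.exp (2 * π * |rowForm c i y|) *
          ((√n)⁻¹) ^ 3 := by
        intro i
        refine (norm_unifChar_sub_le (hM1 n) _).trans ?_
        have e : (M n : ℝ) * |r * rowForm c i y| = (√n)⁻¹ * |rowForm c i y| := by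
          rw [abs_mul, ← mul_assoc, abs_of_pos (by positivity : 0 < r), hMr]
        rw [e]
        have e2 : (2 * π * ((√n)⁻¹ * |rowForm c i y|)) ^ 3 =
          (2 * π * |rowForm c i y|) ^ 3 * ((√n)⁻¹) ^ 3 := by ring
        rw [e2, mul_right_comm]
        have : (√n)⁻¹ ≤ 1 := inv_le_one_of_one_le₀ hs
        have h3 : (√n)⁻¹ * |rowForm c i y| ≤ |rowForm c i y| :=
          mul_le_of_le_one_left (abs_nonneg _) this
        gcongr
      have hsum : (n : ℂ) * (stepChar c (M n) (r • y) - 1) - w n = n * ((∑ i, a i) / q) := by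
        have h0 : ∑ i, ((rowForm c i y : ℝ) : ℂ) = 0 := by
          rw [← Complex.ofReal_sum, sum_rowForm_eq_zero hc, Complex.ofReal_zero]
        have hqc : (q : ℂ) ≠ 0 := by exact_mod_cast hq0.ne'
        have hqc' : (Fintype.card I : ℂ) = q := by rw [hq]; simp
        have h1 : ∑ i, a i = ∑ i, unifChar (M n) (r * rowForm c i y) - (q -
            ((π ^ 2 * ((M n + 1) * (2 * M n + 1)) / 3 * r ^ 2 * Q : ℝ) : ℂ)) := by
          have h2 : ∀ i, a i = unifChar (M n) (r * rowForm c i y) -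
              (1 + (π * (M n + 1) * r * Complex.I) * ((rowForm c i y : ℝ) : ℂ) -
              (π ^ 2 * ((M n + 1) * (2 * M n + 1)) / 3 * r ^ 2) * ((rowForm c i y ^ 2 : ℝ) : ℂ)) := by
            intro i
            simp only [ha]
            push_cast
            ring
          simp only [h2, Finset.sum_sub_distrib, Finset.sum_add_distrib, ← Finset.mul_sum, h0]
          rw [← Complex.ofReal_sum, ← hQ]
          simp only [Finset.sum_const, Finset.card_univ, nsmul_eq_mul, hqc']
          push_cast
          ring
        have h3 : (w n : ℂ) =
            -(n * ((π ^ 2 * ((M n + 1) * (2 * M n + 1)) / 3 * r ^ 2 * Q : ℝ) : ℂ) / q) := by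
          have h4 : w n =
              -(n * (π ^ 2 * ((M n + 1) * (2 * M n + 1)) / 3 * r ^ 2 * Q) / q) := by
            have h5 : (n : ℝ) * r ^ 2 = ((M n : ℝ)⁻¹) ^ 2 := by
              rw [hr, mul_inv, mul_pow, mul_left_comm, hss, mul_one]
            have h6 : (n : ℝ) * (π ^ 2 * ((M n + 1) * (2 * M n + 1)) / 3 * r ^ 2 * Q) =
              (π ^ 2 * ((M n + 1) * (2 * M n + 1)) / 3 * (n * r ^ 2) * Q) := by ring
            rw [h6, h5, hw]
            field_simp
          rw [h4]
          push_cast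
          ring
        rw [h1, h3, stepChar, hqc']
        simp only [rowForm_smul]
        field_simp
        ring
      rw [hsum, norm_mul, norm_div, Complex.norm_natCast, Complex.norm_real, Real.norm_eq_abs,
        abs_of_pos hq0]
      have h7 : ‖∑ i, a i‖ ≤ (B * q) * ((√n)⁻¹) ^ 3 := by
        refine (norm_sum_le _ _).trans ((Finset.sum_le_sum fun i _ => hai i).trans_eq ?_)
        rw [← Finset.sum_mul, hB, div_mul_cancel₀ _ hq0.ne']
      calc (n : ℝ) * (‖∑ i, a i‖ / q) ≤ n * ((B * q) * ((√n)⁻¹) ^ 3 / q) := by gcongr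
        _ = B * (√n)⁻¹ := by
          rw [mul_right_comm B q, mul_div_cancel_right₀ _ hq0.ne']
          linear_combination B * (√n)⁻¹ * hss
    have hB0 : Tendsto (fun n : ℕ => B * (√(n : ℝ))⁻¹) atTop (𝓝 0) := by
      have := (tendsto_inv_atTop_zero.comp
        (Real.tendsto_sqrt_atTop.comp (tendsto_natCast_atTop_atTop (R := ℝ)))).const_mul B
      simpa using this
    have hdiff := squeeze_zero_norm' hbound hB0
    simpa using hdiff.add hwc
  have := Complex.tendsto_one_add_pow_exp_of_tendsto key
  simpa using this

end Asymptotics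

section LocalLimit

variable {I J : Type*} [Fintype I] [Fintype J]

/-- The Gaussian integral that governs the return probability of the walk. -/
noncomputable def gaussMass (c : Matrix I J ℤ) : ℝ :=
  ∫ y : J → ℝ, Real.exp (-(2 * π ^ 2 / (3 * Fintype.card I) * ∑ i, rowForm c i y ^ 2))

lemma integrable_exp_neg_mul_sum_sq {b : ℝ} (hb : 0 < b) :
    Integrable fun y : J → ℝ => Real.exp (-(b * ∑ j, y j ^ 2)) := by
  have e : (fun y : J → ℝ => Real.exp (-(b * ∑ j, y j ^ 2))) =
      fun y => ∏ j, Real.exp (-b * y j ^ 2) := by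
    funext y
    rw [← Real.exp_sum, ← Finset.mul_sum, neg_mul]
  rw [e]
  exact Integrable.fintype_prod (f := fun (_ : J) (v : ℝ) => Real.exp (-b * v ^ 2))
    fun _ => integrable_exp_neg_mul_sq hb

/-- The closed cube of radius `r` around the origin. -/
def closedCube (J : Type*) (r : ℝ) : Set (J → ℝ) := {x | ∀ j, |x j| ≤ r}

lemma measurableSet_closedCube (r : ℝ) : MeasurableSet (closedCube J r) := by
  have : IsClosed (closedCube J r) := by
    simp only [closedCube, Set.ofPred_forall]
    exact isClosed_iInter fun j => isClosed_le (by fun_prop) continuous_const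
  exact this.measurableSet

variable [DecidableEq J] [Nonempty I] {c : Matrix I J ℤ} {A : Matrix J I ℤ} {M : ℕ → ℕ}

lemma tendsto_integral_near (hA : A * c = 1) (hc : ∀ j, ∑ i, c i j = 0) (hM1 : ∀ n, 1 ≤ M n)
    (hM : Tendsto M atTop atTop) {K : ℝ} (hK : 0 < K) :
    Tendsto (fun n : ℕ => (((M n : ℝ) * √n) ^ Fintype.card J) •
      ∫ x in closedCube J (K / M n), stepChar c (M n) x ^ n) atTop
      (𝓝 (gaussMass c : ℂ)) := by
  obtain ⟨b, hb, M₀, -, H⟩ := exists_norm_stepChar_le_of_near hA K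
  have hscale : ∀ n : ℕ, (((M n : ℝ) * √n) ^ Fintype.card J) •
      ∫ x in closedCube J (K / M n), stepChar c (M n) x ^ n =
      ∫ y, (closedCube J (K / M n)).indicator (fun x => stepChar c (M n) x ^ n) (((M n : ℝ) * √n)⁻¹ • y) := by
    intro n
    rw [Measure.integral_comp_inv_smul_of_nonneg volume
      ((closedCube J (K / M n)).indicator (fun x => stepChar c (M n) x ^ n)) (by positivity : 0 ≤ (M n : ℝ) * √n),
      integral_indicator (measurableSet_closedCube _), Module.finrank_fintype_fun_eq_card]
  have hmem : ∀ n : ℕ, 1 ≤ n → ∀ y : J → ℝ, ((M n : ℝ) * √n)⁻¹ • y ∈ closedCube J (K / M n) ↔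
      ∀ j, |(√n)⁻¹ * y j| ≤ K := by
    intro n hn y
    have hm : (0 : ℝ) < M n := by exact_mod_cast hM1 n
    have : ∀ j, |(((M n : ℝ) * √n)⁻¹ • y) j| = |(√n)⁻¹ * y j| / M n := fun j => by
      rw [Pi.smul_apply, smul_eq_mul, mul_inv, mul_assoc, abs_mul (M n : ℝ)⁻¹,
        abs_of_pos (inv_pos.2 hm), inv_mul_eq_div]
    simp only [closedCube, Set.mem_ofPred_eq, this]
    exact forall_congr' fun j => div_le_div_iff_of_pos_right hm
  have hlim : (gaussMass c : ℂ) = ∫ y : J → ℝ, Complex.exp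
      ((-(2 * π ^ 2 / (3 * Fintype.card I) * ∑ i, rowForm c i y ^ 2) : ℝ) : ℂ) := by
    unfold gaussMass
    rw [← integral_complex_ofReal]
    simp only [Complex.ofReal_exp]
  simp only [hscale]
  rw [hlim]
  refine tendsto_integral_filter_of_dominated_convergence
    (fun y : J → ℝ => Real.exp (-(b * ∑ j, y j ^ 2))) ?_ ?_ (integrable_exp_neg_mul_sum_sq hb) ?_
  · refine Eventually.of_forall fun n => Measurable.aestronglyMeasurable ?_
    exact (((continuous_stepChar c (M n)).pow n).measurable.indicator (measurableSet_closedCube _)).comp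
      (measurable_const_smul _)
  · filter_upwards [eventually_ge_atTop 1, hM.eventually_ge_atTop M₀] with n hn hMn
    refine Eventually.of_forall fun y => ?_
    by_cases hy : ((M n : ℝ) * √n)⁻¹ • y ∈ closedCube J (K / M n)
    · rw [Set.indicator_of_mem hy, norm_pow]
      have hn' : (0 : ℝ) < n := by exact_mod_cast hn
      have h1 := H (M n) hMn ((√n)⁻¹ • y) ((hmem n hn y).1 hy)
      rw [smul_smul, ← mul_inv] at h1
      calc ‖stepChar c (M n) (((M n : ℝ) * √n)⁻¹ • y)‖ ^ n
          ≤ Real.exp (-(b * ∑ j, ((√n)⁻¹ • y) j ^ 2)) ^ n := by gcongr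
        _ = Real.exp (-(b * ∑ j, y j ^ 2)) := by
          rw [← Real.exp_nat_mul]
          congr 1
          simp only [Pi.smul_apply, smul_eq_mul, mul_pow, inv_pow, Real.sq_sqrt hn'.le,
            ← Finset.mul_sum]
          field_simp
    · rw [Set.indicator_of_notMem hy, norm_zero]
      positivity
  · refine Eventually.of_forall fun y => ?_
    refine (tendsto_stepChar_pow hc hM1 hM y).congr' ?_
    have hsmall : ∀ j, ∀ᶠ n : ℕ in atTop, |(√n)⁻¹ * y j| ≤ K := by
      intro j
      have h1 : Tendsto (fun n : ℕ => |(√(n : ℝ))⁻¹ * y j|) atTop (𝓝 0) := by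
        have := ((tendsto_inv_atTop_zero.comp (Real.tendsto_sqrt_atTop.comp
          (tendsto_natCast_atTop_atTop (R := ℝ)))).mul_const (y j)).abs
        simpa using this
      exact h1.eventually_le_const hK
    filter_upwards [eventually_ge_atTop 1, eventually_all.2 hsmall] with n hn hy
    rw [Set.indicator_of_mem ((hmem n hn y).2 hy)]

/-- Local limit theorem: the return probability of the walk with steps `X • c i` is asymptotic to
`gaussMass c / (M √n) ^ |J|`. -/
theorem tendsto_zeroSumCount (hA : A * c = 1) (hc : ∀ j, ∑ i, c i j = 0) (hM1 : ∀ n, 1 ≤ M n)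
    (hM : Tendsto M atTop atTop) {κ : ℝ}
    (hκ : Tendsto (fun n : ℕ => (n : ℝ) / Real.log (M n)) atTop (𝓝 κ))
    (hcard : 2 < Fintype.card I)
    (hgt : Fintype.card J < κ * -Real.log (1 - 2 / Fintype.card I)) :
    Tendsto (fun n : ℕ => ((M n : ℝ) * √n) ^ Fintype.card J *
      ((zeroSumCount c n (M n) : ℝ) / ((M n : ℝ) ^ n * (Fintype.card I : ℝ) ^ n))) atTop
      (𝓝 (gaussMass c)) := by
  obtain ⟨C, hC, H⟩ := exists_norm_stepChar_le_of_far hA hc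
  have hq : (0 : ℝ) < 1 - 2 / Fintype.card I := by
    have : (2 : ℝ) < Fintype.card I := by exact_mod_cast hcard
    rw [sub_pos, div_lt_one (by linarith)]
    exact this
  obtain ⟨K, hK, hKρ⟩ : ∃ K : ℝ, 0 < K ∧
      (Fintype.card J : ℝ) < κ * -Real.log (1 - 2 / Fintype.card I + C / K) := by
    have h1 : Tendsto (fun K : ℝ => 1 - 2 / (Fintype.card I : ℝ) + C / K) atTop
        (𝓝 (1 - 2 / (Fintype.card I : ℝ) + 0)) :=
      (tendsto_const_nhds.div_atTop tendsto_id).const_add _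
    rw [add_zero] at h1
    have h2 := ((h1.log hq.ne').neg.const_mul κ).eventually_const_lt hgt
    obtain ⟨K, h3, h4⟩ := (h2.and (eventually_gt_atTop 0)).exists
    exact ⟨K, h4, h3⟩
  set ρ : ℝ := 1 - 2 / Fintype.card I + C / K with hρ
  have hρ0 : 0 < ρ := by positivity
  have hnear := tendsto_integral_near hA hc hM1 hM hK
  have htail : Tendsto (fun n : ℕ => (((M n : ℝ) * √n) ^ Fintype.card J) •
      ∫ x in centredBox J \ closedCube J (K / M n), stepChar c (M n) x ^ n) atTop
      (𝓝 0) := by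
    refine squeeze_zero_norm (fun n => ?_) (tendsto_mul_pow_mul_pow_zero hM1 hκ hρ0 hKρ)
    rw [norm_smul, Real.norm_of_nonneg (by positivity)]
    gcongr
    have hvol : volume (centredBox J \ closedCube J (K / M n)) ≤ 1 :=
      (measure_mono Set.sdiff_subset).trans volume_centredBox.le
    refine (norm_setIntegral_le_of_norm_le_const (C := ρ ^ n)
      (hvol.trans_lt ENNReal.one_lt_top) fun x hx => ?_).trans ?_
    · rw [norm_pow]
      gcongr
      refine H (M n) K (hM1 n) hK x ?_
      have hx2 := hx.2
      simp only [closedCube, Set.mem_ofPred_eq, not_forall, not_le] at hx2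
      obtain ⟨j, hj⟩ := hx2
      refine ⟨j, ?_⟩
      have hb := hx.1 j (Set.mem_univ j)
      have hnorm : ‖(x j : UnitAddCircle)‖ = |x j| := by
        refine (AddCircle.norm_coe_eq_abs_iff (p := 1) one_ne_zero).2 ?_
        rw [abs_one, abs_le]
        exact ⟨hb.1.le, hb.2⟩
      rw [div_lt_iff₀ (by exact_mod_cast hM1 n)] at hj
      rw [hnorm]
      linarith
    · refine mul_le_of_le_one_right (by positivity) ?_
      exact ENNReal.toReal_le_of_le_ofReal zero_le_one (by simpa using hvol)
  have hsum := hnear.add htail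
  rw [add_zero] at hsum
  have hre := (Complex.continuous_re.tendsto _).comp hsum
  rw [Complex.ofReal_re] at hre
  refine hre.congr' ?_
  have hbig := (tendsto_natCast_atTop_atTop (R := ℝ)).comp hM |>.eventually_gt_atTop (2 * K)
  filter_upwards [hbig] with n hn
  have hm : (0 : ℝ) < M n := by exact_mod_cast hM1 n
  have hsub : closedCube J (K / M n) ⊆ centredBox J := by
    intro x hx j _
    have h1 := hx j
    have h2 : K / M n < 1 / 2 := by
      rw [div_lt_div_iff₀ hm two_pos]
      simp only [Function.comp] at hn
      linarith
    have h3 := abs_le.1 h1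
    exact ⟨by linarith, by linarith⟩
  have hint : IntegrableOn (fun x => stepChar c (M n) x ^ n) (centredBox J) :=
    integrableOn_centredBox ((continuous_stepChar c (M n)).pow n)
  have hadd : (∫ x in closedCube J (K / M n), stepChar c (M n) x ^ n) +
      ∫ x in centredBox J \ closedCube J (K / M n), stepChar c (M n) x ^ n =
      (zeroSumCount c n (M n) : ℂ) / ((M n : ℂ) ^ n * (Fintype.card I : ℂ) ^ n) := by
    rw [← integral_stepChar_pow, ← integral_inter_add_sdiff (measurableSet_closedCube _) hint,
      Set.inter_eq_self_of_subset_right hsub]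
  simp only [Function.comp]
  rw [← smul_add, hadd, Complex.real_smul]
  have : ((((M n : ℝ) * √n) ^ Fintype.card J : ℝ) : ℂ) *
      ((zeroSumCount c n (M n) : ℂ) / ((M n : ℂ) ^ n * (Fintype.card I : ℂ) ^ n)) =
      ((((M n : ℝ) * √n) ^ Fintype.card J *
      ((zeroSumCount c n (M n) : ℝ) / ((M n : ℝ) ^ n * (Fintype.card I : ℝ) ^ n)) : ℝ) : ℂ) := by
    push_cast
    ring
  rw [this, Complex.ofReal_re]

end LocalLimit

section Partitions

/-- The steps of the walk recording the differences of the part sums of one partition. -/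
def singleStep (k : ℕ) : Matrix (Fin (k + 1)) (Fin k) ℤ := fun a j =>
  (if a = j.succ then 1 else 0) - if a = 0 then 1 else 0

/-- The steps of the walk recording the differences of the part sums of two partitions, all taken
relative to the first part of the first partition. -/
def pairStep (k : ℕ) : Matrix (Fin (k + 1) × Fin (k + 1)) (Fin k ⊕ Fin k) ℤ := fun a =>
  Sum.elim (fun j => (if a.1 = j.succ then 1 else 0) - if a.1 = 0 then 1 else 0)
    (fun j => (if a.2 = j.succ then 1 else 0) - if a.1 = 0 then 1 else 0)

lemma sum_singleStep (k : ℕ) (j : Fin k) : ∑ i, singleStep k i j = 0 := by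
  simp [singleStep]

lemma sum_pairStep (k : ℕ) (j : Fin k ⊕ Fin k) : ∑ i, pairStep k i j = 0 := by
  have h1 (a : Fin (k + 1)) :
      ∑ x : Fin (k + 1), ∑ _y : Fin (k + 1), (if x = a then (1 : ℤ) else 0) = k + 1 := by
    rw [Finset.sum_comm]
    simp
  have h2 (a : Fin (k + 1)) :
      ∑ _x : Fin (k + 1), ∑ y : Fin (k + 1), (if y = a then (1 : ℤ) else 0) = k + 1 := by
    simp
  rw [Fintype.sum_prod_type]
  rcases j with j | j <;>
    simp only [pairStep, Sum.elim_inl, Sum.elim_inr, Finset.sum_sub_distrib, h1, h2, sub_self]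

lemma exists_mul_singleStep (k : ℕ) :
    ∃ A : Matrix (Fin k) (Fin (k + 1)) ℤ, A * singleStep k = 1 := by
  refine ⟨Matrix.of fun j a => if a = j.succ then 1 else 0, ?_⟩
  ext j j'
  simp [Matrix.mul_apply, singleStep, Matrix.one_apply]

lemma exists_mul_pairStep (k : ℕ) :
    ∃ A : Matrix (Fin k ⊕ Fin k) (Fin (k + 1) × Fin (k + 1)) ℤ, A * pairStep k = 1 := by
  refine ⟨Matrix.of <| Sum.elim (fun j a => if a = (j.succ, 0) then 1 else 0)
    (fun j a => (if a = (0, j.succ) then 1 else 0) - if a = (0, 0) then 1 else 0), ?_⟩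
  ext j j'
  rcases j with j | j <;> rcases j' with j' | j' <;>
    simp [Matrix.mul_apply, pairStep, Matrix.one_apply, sub_mul, Finset.sum_sub_distrib,
      (Fin.succ_ne_zero _).symm]

/-- The sum of `X` over the part of `σ` labelled `a`. -/
def partSum {ν n : ℕ} (X : Fin n → ℕ) (σ : Fin n → Fin ν) (a : Fin ν) : ℕ :=
  ∑ t ∈ Finset.univ.filter fun t => σ t = a, X t

lemma sum_partSum {ν n : ℕ} (X : Fin n → ℕ) (σ : Fin n → Fin ν) :
    ∑ a, partSum X σ a = ∑ t, X t :=
  Finset.sum_fiberwise _ _ _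

lemma perfectCount_eq {k n : ℕ} (hn : 1 ≤ n) {X : Fin n → ℕ} (hX : ∀ t, 0 < X t) :
    perfectCount (k + 1) n X = (Finset.univ.filter fun σ : Fin n → Fin (k + 1) =>
      ∀ j : Fin k, partSum X σ j.succ = partSum X σ 0).card := by
  rw [← Set.ncard_coe_finset, perfectCount]
  congr 1
  ext σ
  simp only [Finset.coe_filter, Finset.mem_univ, true_and, Set.mem_ofPred_eq]
  refine ⟨fun h j => h.2 _ _, fun h => ?_⟩
  have h0 : ∀ a, partSum X σ a = partSum X σ 0 := fun a => Fin.cases rfl h a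
  refine ⟨fun a => ?_, fun a b => (h0 a).trans (h0 b).symm⟩
  by_contra! hcon
  have ha : partSum X σ a = 0 := by
    unfold partSum
    rw [Finset.filter_false_of_mem fun t _ => hcon t, Finset.sum_empty]
  have hb : X ⟨0, hn⟩ ≤ partSum X σ (σ ⟨0, hn⟩) :=
    Finset.single_le_sum (f := X) (fun _ _ => Nat.zero_le _) (by simp)
  rw [h0, ← h0 a, ha] at hb
  exact absurd (hX ⟨0, hn⟩) (by omega)

lemma sum_mul_ite_eq_partSum {ν n : ℕ} (X : Fin n → ℕ) (σ : Fin n → Fin ν) (a : Fin ν) :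
    ∑ t, ((X t : ℕ) : ℤ) * (if σ t = a then 1 else 0) = partSum X σ a := by
  unfold partSum
  rw [Finset.sum_filter]
  push_cast
  simp

lemma zeroSumCount_eq_sum {I J : Type*} [Fintype I] [Fintype J] (c : Matrix I J ℤ) (n M : ℕ) :
    zeroSumCount c n M = ∑ X : Fin n → Fin M, (Finset.univ.filter fun s : Fin n → I =>
      ∀ j, ∑ t, (((X t : ℕ) + 1 : ℕ) : ℤ) * c (s t) j = 0).card := by
  unfold zeroSumCount
  simp only [Finset.card_filter]
  rw [← Fintype.sum_prod_type' (f := fun (X : Fin n → Fin M) (s : Fin n → I) =>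
    if ∀ j, ∑ t, (((X t : ℕ) + 1 : ℕ) : ℤ) * c (s t) j = 0 then 1 else 0)]
  refine Fintype.sum_equiv (Equiv.arrowProdEquivProdArrow (Fin n) (fun _ => Fin M) (fun _ => I))
    _ _ fun p => ?_
  simp [Equiv.arrowProdEquivProdArrow]

lemma sum_perfectCount {k n : ℕ} (hn : 1 ≤ n) (M : ℕ) :
    ∑ X : Fin n → Fin M, perfectCount (k + 1) n (fun t => (X t : ℕ) + 1) =
      zeroSumCount (singleStep k) n M := by
  rw [zeroSumCount_eq_sum]
  refine Finset.sum_congr rfl fun X _ => ?_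
  rw [perfectCount_eq hn fun _ => Nat.succ_pos _]
  congr 1
  ext σ
  simp only [Finset.mem_filter, Finset.mem_univ, true_and]
  refine forall_congr' fun j => ?_
  simp only [singleStep, mul_sub, Finset.sum_sub_distrib]
  rw [sum_mul_ite_eq_partSum (fun t => (X t : ℕ) + 1), sum_mul_ite_eq_partSum
    (fun t => (X t : ℕ) + 1), sub_eq_zero]
  exact_mod_cast Iff.rfl

lemma partSum_eq_iff {k n : ℕ} (X : Fin n → ℕ) (σ τ : Fin n → Fin (k + 1)) :
    ((∀ j : Fin k, partSum X σ j.succ = partSum X σ 0) ∧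
      ∀ j : Fin k, partSum X τ j.succ = partSum X τ 0) ↔
    ((∀ j : Fin k, partSum X σ j.succ = partSum X σ 0) ∧
      ∀ j : Fin k, partSum X τ j.succ = partSum X σ 0) := by
  refine and_congr_right fun hσ => ?_
  have hsum : ∑ a, partSum X σ a = ∑ a, partSum X τ a := by rw [sum_partSum, sum_partSum]
  rw [Fin.sum_univ_succ, Fin.sum_univ_succ, Finset.sum_congr rfl fun j _ => hσ j] at hsum
  have : (∀ j : Fin k, partSum X τ j.succ = partSum X τ 0) ∨
      (∀ j : Fin k, partSum X τ j.succ = partSum X σ 0) → partSum X σ 0 = partSum X τ 0 := by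
    rintro (hτ | hτ)
    · rw [Finset.sum_congr rfl fun j _ => hτ j] at hsum
      simp only [Finset.sum_const, Finset.card_univ, Fintype.card_fin, smul_eq_mul] at hsum
      nlinarith
    · rw [Finset.sum_congr rfl fun j _ => hτ j] at hsum
      exact Nat.add_right_cancel hsum
  constructor
  · intro h
    rw [this (Or.inl h)]
    exact h
  · intro h
    rw [← this (Or.inr h)]
    exact h

lemma sum_perfectCount_sq {k n : ℕ} (hn : 1 ≤ n) (M : ℕ) :
    ∑ X : Fin n → Fin M, perfectCount (k + 1) n (fun t => (X t : ℕ) + 1) ^ 2 =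
      zeroSumCount (pairStep k) n M := by
  rw [zeroSumCount_eq_sum]
  refine Finset.sum_congr rfl fun X _ => ?_
  rw [perfectCount_eq hn fun _ => Nat.succ_pos _, sq, ← Finset.card_product]
  refine Finset.card_equiv
    (Equiv.arrowProdEquivProdArrow (Fin n) (fun _ => Fin (k + 1)) (fun _ => Fin (k + 1))).symm
    fun p => ?_
  simp only [Finset.mem_product, Finset.mem_filter, Finset.mem_univ, true_and, partSum_eq_iff]
  rw [Sum.forall]
  refine and_congr (forall_congr' fun j => ?_) (forall_congr' fun j => ?_)
  · change _ ↔ ∑ t, (((X t : ℕ) + 1 : ℕ) : ℤ) *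
      ((if p.1 t = j.succ then 1 else 0) - if p.1 t = 0 then 1 else 0) = 0
    simp only [mul_sub, Finset.sum_sub_distrib]
    rw [sum_mul_ite_eq_partSum (fun t => (X t : ℕ) + 1), sum_mul_ite_eq_partSum
      (fun t => (X t : ℕ) + 1), sub_eq_zero]
    exact_mod_cast Iff.rfl
  · change _ ↔ ∑ t, (((X t : ℕ) + 1 : ℕ) : ℤ) *
      ((if p.2 t = j.succ then 1 else 0) - if p.1 t = 0 then 1 else 0) = 0
    simp only [mul_sub, Finset.sum_sub_distrib]
    rw [sum_mul_ite_eq_partSum (fun t => (X t : ℕ) + 1), sum_mul_ite_eq_partSum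
      (fun t => (X t : ℕ) + 1), sub_eq_zero]
    exact_mod_cast Iff.rfl

lemma EZ_eq {k n : ℕ} (hn : 1 ≤ n) (M : ℕ) :
    EZ (k + 1) n M = zeroSumCount (singleStep k) n M / (M : ℝ) ^ n := by
  rw [EZ, ← sum_perfectCount hn]
  push_cast
  rfl

lemma EZsq_eq {k n : ℕ} (hn : 1 ≤ n) (M : ℕ) :
    EZsq (k + 1) n M = zeroSumCount (pairStep k) n M / (M : ℝ) ^ n := by
  rw [EZsq, ← sum_perfectCount_sq hn]
  push_cast
  rfl

end Partitions

section Gaussian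

lemma rowForm_singleStep (k : ℕ) (a : Fin (k + 1)) (x : Fin k → ℝ) :
    rowForm (singleStep k) a x = (Fin.cons (-∑ j, x j) x : Fin (k + 1) → ℝ) a := by
  refine Fin.cases ?_ (fun j => ?_) a
  · simp [rowForm, singleStep, (Fin.succ_ne_zero _).symm]
  · simp [rowForm, singleStep]

/-- The change of variables that decouples the two partitions. -/
def decouple (k : ℕ) : Matrix (Fin k ⊕ Fin k) (Fin k ⊕ Fin k) ℝ :=
  Matrix.fromBlocks 1 (-Matrix.of fun _ _ => 1) 0 (1 + Matrix.of fun _ _ => 1)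

lemma det_decouple (k : ℕ) : (decouple k).det = k + 1 := by
  have h : (Matrix.of fun _ _ => 1 : Matrix (Fin k) (Fin k) ℝ) =
      (Matrix.replicateCol Unit 1 : Matrix (Fin k) Unit ℝ) *
        (Matrix.replicateRow Unit 1 : Matrix Unit (Fin k) ℝ) := by
    ext
    simp [Matrix.mul_apply]
  rw [decouple, Matrix.det_fromBlocks_zero₂₁, h,
    Matrix.det_one_add_replicateCol_mul_replicateRow]
  simp [add_comm]

lemma decouple_mulVec_inl (k : ℕ) (z : Fin k ⊕ Fin k → ℝ) (j : Fin k) :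
    (decouple k).mulVec z (Sum.inl j) = z (Sum.inl j) - ∑ i, z (Sum.inr i) := by
  rw [decouple, Matrix.fromBlocks_mulVec]
  simp [Matrix.mulVec, dotProduct, sub_eq_add_neg]

lemma decouple_mulVec_inr (k : ℕ) (z : Fin k ⊕ Fin k → ℝ) (j : Fin k) :
    (decouple k).mulVec z (Sum.inr j) = z (Sum.inr j) + ∑ i, z (Sum.inr i) := by
  rw [decouple, Matrix.fromBlocks_mulVec]
  simp [Matrix.mulVec, dotProduct, Matrix.one_apply, add_mul, Finset.sum_add_distrib]

lemma rowForm_pairStep_decouple (k : ℕ) (a : Fin (k + 1) × Fin (k + 1))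
    (z : Fin k ⊕ Fin k → ℝ) :
    rowForm (pairStep k) a ((decouple k).mulVec z) =
      rowForm (singleStep k) a.1 (fun j => z (Sum.inl j)) +
        rowForm (singleStep k) a.2 (fun j => z (Sum.inr j)) := by
  obtain ⟨a, b⟩ := a
  rw [rowForm_singleStep, rowForm_singleStep, rowForm, Fintype.sum_sum_type]
  simp only [decouple_mulVec_inl, decouple_mulVec_inr, pairStep, Sum.elim_inl, Sum.elim_inr]
  refine Fin.cases ?_ (fun i => ?_) a <;> refine Fin.cases ?_ (fun i' => ?_) b <;>
    simp [(Fin.succ_ne_zero _).symm, Finset.sum_add_distrib, sub_mul, Finset.sum_sub_distrib]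
  all_goals ring

lemma sum_rowForm_pairStep_sq (k : ℕ) (z : Fin k ⊕ Fin k → ℝ) :
    ∑ a, rowForm (pairStep k) a ((decouple k).mulVec z) ^ 2 =
      (k + 1) * (∑ a, rowForm (singleStep k) a (fun j => z (Sum.inl j)) ^ 2 +
        ∑ a, rowForm (singleStep k) a (fun j => z (Sum.inr j)) ^ 2) := by
  simp only [rowForm_pairStep_decouple]
  have h := sum_rowForm_eq_zero (sum_singleStep k) (fun j => z (Sum.inr j))
  rw [Fintype.sum_prod_type]
  simp only [add_sq, Finset.sum_add_distrib, ← Finset.mul_sum, h, mul_zero, Finset.sum_const,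
    Finset.card_univ, Fintype.card_fin, nsmul_eq_mul]
  push_cast
  ring

lemma integral_eq_abs_det_mul {ι : Type*} [Fintype ι] [DecidableEq ι] {T : Matrix ι ι ℝ}
    (hT : T.det ≠ 0) {f : (ι → ℝ) → ℝ} (hf : Continuous f) :
    ∫ y, f y = |T.det| * ∫ z, f (T.mulVec z) := by
  have hmap := Real.map_matrix_volume_pi_eq_smul_volume_pi hT
  have hcont : Continuous (Matrix.toLin' T) := LinearMap.continuous_of_finiteDimensional _
  have h := integral_map (μ := volume) (f := f) hcont.measurable.aemeasurable
    hf.aestronglyMeasurable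
  rw [hmap, integral_smul_measure, ENNReal.toReal_ofReal (abs_nonneg _), abs_inv] at h
  simp only [Matrix.toLin'_apply, smul_eq_mul] at h
  rw [← h, mul_inv_cancel_left₀ (abs_ne_zero.2 hT)]

lemma gaussMass_pairStep (k : ℕ) :
    gaussMass (pairStep k) = (k + 1) * gaussMass (singleStep k) ^ 2 := by
  have hk : (0 : ℝ) < k + 1 := by positivity
  have hdet : (decouple k).det ≠ 0 := by rw [det_decouple]; exact hk.ne'
  have hcont : Continuous fun y : Fin k ⊕ Fin k → ℝ => Real.exp (-(2 * π ^ 2 /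
      (3 * Fintype.card (Fin (k + 1) × Fin (k + 1))) * ∑ i, rowForm (pairStep k) i y ^ 2)) := by
    have := continuous_rowForm (pairStep k)
    fun_prop
  rw [gaussMass, integral_eq_abs_det_mul hdet hcont, det_decouple, abs_of_pos hk]
  congr 1
  rw [gaussMass, sq (∫ _, _), ← integral_prod_mul, ← Measure.volume_eq_prod,
    ← (volume_measurePreserving_sumPiEquivProdPi fun _ : Fin k ⊕ Fin k => ℝ).integral_comp'
      (g := fun p : (Fin k → ℝ) × (Fin k → ℝ) => _)]
  refine integral_congr_ae (Eventually.of_forall fun z => ?_)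
  simp only [sum_rowForm_pairStep_sq]
  rw [← Real.exp_add]
  congr 1
  simp only [Fintype.card_prod, Fintype.card_fin, MeasurableEquiv.coe_sumPiEquivProdPi,
    Equiv.sumPiEquivProdPi]
  push_cast
  simp only [Equiv.coe_fn_mk]
  field_simp
  ring

lemma gaussMass_singleStep_pos (k : ℕ) : 0 < gaussMass (singleStep k) := by
  have hb : 0 < 2 * π ^ 2 / (3 * (Fintype.card (Fin (k + 1)) : ℝ)) := by
    rw [Fintype.card_fin]
    positivity
  refine integral_exp_pos ((integrable_exp_neg_mul_sum_sq hb).mono' ?_ ?_)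
  · have := continuous_rowForm (singleStep k)
    exact Continuous.aestronglyMeasurable (by fun_prop)
  · refine Eventually.of_forall fun y => ?_
    rw [Real.norm_of_nonneg (Real.exp_pos _).le, Real.exp_le_exp, neg_le_neg_iff]
    refine mul_le_mul_of_nonneg_left ?_ hb.le
    simp only [rowForm_singleStep, Fin.sum_univ_succ, Fin.cons_succ]
    exact le_add_of_nonneg_left (sq_nonneg _)

end Gaussian

section Ratio

lemma tendsto_secondMoment_ratio {k : ℕ} (hk : 2 ≤ k) {M : ℕ → ℕ} (hM1 : ∀ n, 1 ≤ M n)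
    (hM : Tendsto M atTop atTop) {κ : ℝ}
    (hκ : Tendsto (fun n : ℕ => (n : ℝ) / Real.log (M n)) atTop (𝓝 κ))
    (hgt : 2 * (k : ℝ) / Real.log ((1 - 2 / ((k : ℝ) + 1) ^ 2)⁻¹) < κ) :
    Tendsto (fun n => EZsq (k + 1) n (M n) / EZ (k + 1) n (M n) ^ 2) atTop (𝓝 (k + 1)) := by
  have hk' : (2 : ℝ) ≤ k := by exact_mod_cast hk
  have hle : 2 / ((k : ℝ) + 1) ^ 2 ≤ 2 / ((k : ℝ) + 1) := by
    gcongr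
    nlinarith
  have hlt : 2 / ((k : ℝ) + 1) < 1 := by
    rw [div_lt_one (by positivity)]
    linarith
  have hpos : 0 < 2 / ((k : ℝ) + 1) ^ 2 := by positivity
  have hL : 0 < -Real.log (1 - 2 / ((k : ℝ) + 1) ^ 2) :=
    neg_pos.2 (Real.log_neg (by linarith) (by linarith))
  rw [Real.log_inv] at hgt
  have hκ0 : 0 < κ := lt_trans (by positivity) hgt
  rw [div_lt_iff₀ hL] at hgt
  have hlog : Real.log (1 - 2 / ((k : ℝ) + 1)) ≤ Real.log (1 - 2 / ((k : ℝ) + 1) ^ 2) :=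
    Real.log_le_log (by linarith) (by linarith)
  obtain ⟨A, hA⟩ := exists_mul_singleStep k
  obtain ⟨B, hB⟩ := exists_mul_pairStep k
  have h1 := tendsto_zeroSumCount hA (sum_singleStep k) hM1 hM hκ (by simp; omega) (by
    simp only [Fintype.card_fin]
    push_cast
    nlinarith)
  have h2 := tendsto_zeroSumCount hB (sum_pairStep k) hM1 hM hκ (by simp; nlinarith) (by
    simp only [Fintype.card_prod, Fintype.card_sum, Fintype.card_fin]
    push_cast
    rw [← sq]
    linarith)
  have hG := gaussMass_singleStep_pos k
  have h3 := h2.div (h1.pow 2) (by positivity)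
  rw [gaussMass_pairStep, mul_div_assoc, div_self (by positivity), mul_one] at h3
  refine h3.congr' ?_
  filter_upwards [eventually_ge_atTop 1] with n hn
  rw [EZ_eq hn, EZsq_eq hn]
  have hMn : (0 : ℝ) < M n := by exact_mod_cast hM1 n
  have hn' : (0 : ℝ) < √n := Real.sqrt_pos.2 (by exact_mod_cast hn)
  simp only [Pi.div_apply, Fintype.card_prod, Fintype.card_sum, Fintype.card_fin]
  generalize (zeroSumCount (pairStep k) n (M n) : ℝ) = u
  generalize (zeroSumCount (singleStep k) n (M n) : ℝ) = v
  push_cast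
  have hR : ((M n : ℝ) * √n) ^ k ≠ 0 := by positivity
  have hq : ((k : ℝ) + 1) ^ n ≠ 0 := by positivity
  have hMn' : (M n : ℝ) ^ n ≠ 0 := by positivity
  rw [pow_add, mul_pow _ _ n]
  generalize ((M n : ℝ) * √n) ^ k = r at *
  generalize ((k : ℝ) + 1) ^ n = q at *
  generalize (M n : ℝ) ^ n = m at *
  rcases eq_or_ne v 0 with rfl | hv
  · simp
  · field_simp

end Ratio

theorem second_moment_ratio_bounded
    (ν : ℕ) (hν : 3 ≤ ν) (M : ℕ → ℕ) (hM1 : ∀ n, 1 ≤ M n)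
    (hMtop : Tendsto M atTop atTop)
    (hMO : ∃ C : ℝ, ∀ n : ℕ, Real.log (M n) ≤ C * n)
    (κ : ℝ)
    (hκ : Tendsto (fun n : ℕ => (n : ℝ) / Real.log (M n)) atTop (nhds κ))
    (hκgt : 2 * ((ν : ℝ) - 1) / Real.log ((1 - 2 / (ν : ℝ) ^ 2)⁻¹) < κ) :
    Filter.limsup (fun n => EZsq ν n (M n) / (EZ ν n (M n)) ^ 2) atTop ≤ (ν : ℝ) ^ 2 := by
  obtain ⟨k, rfl⟩ : ∃ k, ν = k + 1 := ⟨ν - 1, by omega⟩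
  push_cast at hκgt ⊢
  rw [add_sub_cancel_right] at hκgt
  rw [(tendsto_secondMoment_ratio (by omega) hM1 hMtop hκ hκgt).limsup_eq]
  have : (0 : ℝ) ≤ k := k.cast_nonneg
  nlinarith
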